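/- Let W = (w_{ij}) be a symmetric N × N real matrix (N ≥ 2) with nonnegative entries and zero diagonal such that every strength s_i = Σ_j w_{ij} is positive, and let L = S − W with S = diag(s_1,…,s_N) be its Laplacian. Suppose L has eigenvalues 0 = θ_1 < θ_2 ≤ … ≤ θ_N (in particular zero is a simple eigenvalue) with a corresponding orthonormal basis of eigenvectors φ_1,…,φ_N, where φ_1 = (1/√N)(1,…,1)ᵀ. Define for all i, j: T_{ij} = Σ_{z=1}^N s_z Σ_{k=2}^N (1/θ_k)·(φ_{kj}² − φ_{ki}φ_{kj} − φ_{kj}φ_{kz} + φ_{ki}φ_{kz}). Then T_{jj} = 0 for every j, and for all i ≠ j: T_{ij} = 1 + Σ_{k=1}^N (w_{ik}/s_i)·T_{kj}; that is, T_{ij} is the mean hitting time from i to j of the random walk on the weighted graph W with transition probabilities p_{ik} = w_{ik}/s_i. -/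

import Mathlib

open Finset

/-- An orthonormal family of `n` vectors in `ℝⁿ` is complete: the dual relations hold as well. -/
theorem sum_mul_eq_ite_of_orthonormal {n : Type*} [Fintype n] [DecidableEq n] (φ : n → n → ℝ)
    (horth : ∀ k l, (∑ z, φ k z * φ l z) = if k = l then 1 else 0) (i j : n) :
    ∑ k, φ k i * φ k j = if i = j then 1 else 0 := by
  have h : Matrix.of φ * (Matrix.of φ).transpose = 1 := by
    ext k l
    simpa [Matrix.mul_apply, Matrix.one_apply] using horth k l
  rw [mul_eq_one_comm] at h
  have h' := congrFun (congrFun h i) j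
  simpa [Matrix.mul_apply, Matrix.one_apply] using h'

/-- The weighted Laplacian acts as a sum of weighted differences. -/
theorem laplacian_mulVec_eq_sum_sub {n : Type*} [Fintype n] [DecidableEq n] (W : Matrix n n ℝ)
    (s : n → ℝ) (hs : ∀ i, s i = ∑ j, W i j) (f : n → ℝ) (i : n) :
    (Matrix.diagonal s - W).mulVec f i = ∑ k, W i k * (f i - f k) := by
  rw [Matrix.sub_mulVec, Pi.sub_apply, Matrix.mulVec_diagonal, hs i]
  simp only [mul_sub, Finset.sum_sub_distrib, Finset.sum_mul, Matrix.mulVec, dotProduct]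

/-- Spectral formula for hitting times of the random walk on a weighted graph `W`:
the quantity `T_{ij}` built from the eigenvalues and orthonormal eigenvectors of the
Laplacian `L = S - W` vanishes on the diagonal and satisfies the first-step equations
`T_{ij} = 1 + ∑_k (w_{ik}/s_i) T_{kj}` for `i ≠ j`; hence it is the mean hitting time. -/
theorem weighted_hitting_time_spectral (N : ℕ) [NeZero N] (hN : 2 ≤ N)
    (W : Matrix (Fin N) (Fin N) ℝ)
    (hSymm : ∀ i j, W i j = W j i)
    (hnn : ∀ i j, 0 ≤ W i j)
    (hdiag : ∀ i, W i i = 0)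
    (s : Fin N → ℝ) (hs : ∀ i, s i = ∑ j, W i j) (hspos : ∀ i, 0 < s i)
    (θ : Fin N → ℝ) (φ : Fin N → Fin N → ℝ)
    (hθ0 : θ 0 = 0) (hθpos : ∀ k, k ≠ 0 → 0 < θ k) (hθmono : Monotone θ)
    (heig : ∀ k, (Matrix.diagonal s - W).mulVec (φ k) = θ k • φ k)
    (horth : ∀ k l, (∑ z, φ k z * φ l z) = if k = l then 1 else 0)
    (hφ0 : ∀ z, φ 0 z = 1 / Real.sqrt N)
    (T : Fin N → Fin N → ℝ)
    (hT : ∀ i j, T i j = ∑ z, s z * ∑ k ∈ Finset.univ \ {0}, (1 / θ k) *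
      (φ k j ^ 2 - φ k i * φ k j - φ k j * φ k z + φ k i * φ k z)) :
    (∀ j, T j j = 0) ∧
      ∀ i j, i ≠ j → T i j = 1 + ∑ k, (W i k / s i) * T k j := by
  refine ⟨fun j => ?_, fun i j hij => ?_⟩
  · rw [hT]
    refine Finset.sum_eq_zero fun z _ => ?_
    rw [Finset.sum_eq_zero fun k _ => by ring, mul_zero]
  have hdiff (k : Fin N) : T i j - T k j = ∑ z, s z * ∑ l ∈ Finset.univ \ {0},
      (1 / θ l) * ((φ l z - φ l j) * (φ l i - φ l k)) := by
    rw [hT, hT, ← Finset.sum_sub_distrib]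
    refine Finset.sum_congr rfl fun z _ => ?_
    rw [← mul_sub, ← Finset.sum_sub_distrib]
    congr 1
    exact Finset.sum_congr rfl fun l _ => by ring
  have hL (l : Fin N) : ∑ k, W i k * (φ l i - φ l k) = θ l * φ l i := by
    rw [← laplacian_mulVec_eq_sum_sub W s hs, heig l, Pi.smul_apply, smul_eq_mul]
  have hinner (z : Fin N) :
      ∑ k, W i k * ∑ l ∈ Finset.univ \ {0}, (1 / θ l) * ((φ l z - φ l j) * (φ l i - φ l k)) =
        if i = z then 1 else 0 := by
    calc
      _ = ∑ l ∈ Finset.univ \ {0}, (1 / θ l) * (φ l z - φ l j) *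
            ∑ k, W i k * (φ l i - φ l k) := by
        simp only [Finset.mul_sum]
        rw [Finset.sum_comm]
        exact Finset.sum_congr rfl fun l _ => Finset.sum_congr rfl fun k _ => by ring
      _ = ∑ l ∈ Finset.univ \ {0}, (φ l i * φ l z - φ l i * φ l j) := by
        refine Finset.sum_congr rfl fun l hl => ?_
        have hl0 : θ l ≠ 0 := (hθpos l (by simpa using hl)).ne'
        rw [hL]
        field_simp
      _ = ∑ l, (φ l i * φ l z - φ l i * φ l j) := by
        refine Finset.sum_subset (Finset.subset_univ _) fun l _ hl => ?_
        obtain rfl : l = 0 := by simpa using hl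
        rw [hφ0 z, hφ0 j, sub_self]
      _ = if i = z then 1 else 0 := by
        rw [Finset.sum_sub_distrib, sum_mul_eq_ite_of_orthonormal φ horth,
          sum_mul_eq_ite_of_orthonormal φ horth, if_neg hij, sub_zero]
  have hstep : ∑ k, W i k * (T i j - T k j) = s i := by
    calc
      _ = ∑ z, s z * ∑ k, W i k * ∑ l ∈ Finset.univ \ {0},
            (1 / θ l) * ((φ l z - φ l j) * (φ l i - φ l k)) := by
        simp only [hdiff]
        simp_rw [Finset.mul_sum (s := Finset.univ)]
        rw [Finset.sum_comm]
        exact Finset.sum_congr rfl fun z _ => Finset.sum_congr rfl fun k _ => by ring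
      _ = s i := by simp only [hinner]; simp
  have hsi : s i ≠ 0 := (hspos i).ne'
  simp only [mul_sub, Finset.sum_sub_distrib, ← Finset.sum_mul, ← hs i] at hstep
  simp only [div_mul_eq_mul_div, ← Finset.sum_div]
  field_simp
  linarith
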